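/- Let α : ℝ → ℝ be a locally Lipschitz extended class-K function, i.e., α is strictly monotone increasing and α(0) = 0. Let y : ℝ → ℝ be differentiable with y(0) ≥ 0, and suppose that for all t ≥ 0 the derivative satisfies y'(t) ≥ -α(y(t)). Then y(t) ≥ 0 for all t ≥ 0. -/

import Mathlib

open Real

/-- Scalar comparison (barrier) lemma: if `α` is a locally Lipschitz extended
class-K function (strictly increasing, `α 0 = 0`), `y` is differentiable with
`y 0 ≥ 0`, and `y' t ≥ -α (y t)` for all `t ≥ 0`, then `y t ≥ 0` for all `t ≥ 0`. -/
theorem barrier_comparison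
    (α : ℝ → ℝ) (hα_lip : LocallyLipschitz α) (hα_mono : StrictMono α)
    (hα0 : α 0 = 0)
    (y : ℝ → ℝ) (hy : Differentiable ℝ y)
    (hy0 : 0 ≤ y 0)
    (hineq : ∀ t ≥ (0 : ℝ), deriv y t ≥ -α (y t)) :
    ∀ t ≥ (0 : ℝ), 0 ≤ y t := by
  intro t ht
  refine le_of_forall_pos_le_add fun ε hε => ?_
  have hbound : -y t ≤ ε :=
    image_le_of_deriv_right_lt_deriv_boundary (f := fun s => -y s) (f' := fun s => -deriv y s)
      (B := fun _ => ε) (B' := fun _ => 0) (a := 0) (b := t)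
      hy.continuous.neg.continuousOn
      (fun s _ => (hy s).hasDerivAt.neg.hasDerivWithinAt)
      (by linarith)
      (fun s => hasDerivAt_const s ε)
      (fun s hs hys => by
        have hneg : α (y s) < 0 := hα0 ▸ hα_mono (by linarith : y s < 0)
        linarith [hineq s hs.1])
      ⟨ht, le_rfl⟩
  linarith
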